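/- Fix an integer k ≥ 1. There exist constants c_k > 0 and C_k > 0 such that the following holds: for all integers d ≥ 1 and N ≥ 1 and all real numbers α_1,…,α_d, one has min_{1≤n≤N} max_{1≤i≤d} ‖α_i n^k‖_{ℝ/ℤ} ≤ C_k · d · N^{−c_k/d²}. -/

import Mathlib

/-- The distance from a real number to the nearest integer. -/
noncomputable def distInt (x : ℝ) : ℝ := |x - round x|

lemma distInt_nonneg (x : ℝ) : 0 ≤ distInt x := abs_nonneg _

lemma distInt_le_abs_sub (x : ℝ) (a : ℤ) : distInt x ≤ |x - a| := round_le x a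

lemma distInt_le_half (x : ℝ) : distInt x ≤ 1 / 2 := abs_sub_round x

lemma distInt_add_le (x y : ℝ) : distInt (x + y) ≤ distInt x + distInt y := by
  have h := distInt_le_abs_sub (x + y) (round x + round y)
  refine h.trans (le_trans (le_of_eq ?_) (abs_add_le (x - round x) (y - round y)))
  push_cast
  ring_nf

lemma distInt_neg (x : ℝ) : distInt (-x) = distInt x := by
  have key : ∀ y : ℝ, distInt (-y) ≤ distInt y := fun y => by
    refine (distInt_le_abs_sub (-y) (-round y)).trans (le_of_eq ?_)
    rw [distInt, ← abs_neg]
    push_cast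
    ring_nf
  exact le_antisymm (key x) (by simpa using key (-x))

lemma distInt_intCast_mul_le (a : ℤ) (x : ℝ) : distInt (a * x) ≤ |(a : ℝ)| * distInt x := by
  refine (distInt_le_abs_sub (a * x) (a * round x)).trans (le_of_eq ?_)
  rw [distInt, ← abs_mul]
  push_cast
  ring_nf

lemma distInt_natCast_mul_le (a : ℕ) (x : ℝ) : distInt (a * x) ≤ a * distInt x := by
  simpa using distInt_intCast_mul_le a x

lemma distInt_sum_le {ι : Type*} (s : Finset ι) (f : ι → ℝ) :
    distInt (∑ i ∈ s, f i) ≤ ∑ i ∈ s, distInt (f i) :=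
  Finset.le_sum_of_subadditive distInt (by simp [distInt]) distInt_add_le s f

/-- A real number of absolute value at most `1 / 2` is its own distance to the integers. -/
lemma distInt_eq_abs {x : ℝ} (hx : |x| ≤ 1 / 2) : distInt x = |x| := by
  refine le_antisymm (by simpa using distInt_le_abs_sub x 0) ?_
  by_cases h0 : round x = 0
  · simp [distInt, h0]
  · have h1 : (1 : ℝ) ≤ |(round x : ℝ)| := by
      exact_mod_cast Int.one_le_abs h0
    have h2 := abs_sub_abs_le_abs_sub (round x : ℝ) x
    rw [distInt, abs_sub_comm]
    linarith

lemma distInt_add_intCast (x : ℝ) (a : ℤ) : distInt (x + a) = distInt x := by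
  simp [distInt]

lemma cos_two_pi_mul_eq (x : ℝ) :
    Real.cos (2 * Real.pi * x) = Real.cos (2 * Real.pi * distInt x) := by
  have h : Real.cos (2 * Real.pi * distInt x) = Real.cos (2 * Real.pi * (x - round x)) := by
    rw [← Real.cos_abs (2 * Real.pi * (x - round x)), abs_mul, abs_of_pos Real.two_pi_pos, distInt]
  rw [h, show 2 * Real.pi * (x - round x) = 2 * Real.pi * x - round x * (2 * Real.pi) by ring,
    Real.cos_sub_int_mul_two_pi]

lemma cos_two_pi_mul_le (x : ℝ) :
    Real.cos (2 * Real.pi * x) ≤ 1 - 8 * distInt x ^ 2 := by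
  rw [cos_two_pi_mul_eq]
  have hπ := Real.pi_pos
  have h0 := distInt_nonneg x
  have h1 := distInt_le_half x
  refine (Real.cos_le_one_sub_mul_cos_sq (x := 2 * Real.pi * distInt x) ?_).trans (le_of_eq ?_)
  · rw [abs_of_nonneg (by positivity)]
    nlinarith
  · field_simp
    ring

lemma cos_two_pi_mul_nonneg {x : ℝ} (hx : distInt x ≤ 1 / 4) :
    0 ≤ Real.cos (2 * Real.pi * x) := by
  rw [cos_two_pi_mul_eq]
  have hπ := Real.pi_pos
  have h0 := distInt_nonneg x
  apply Real.cos_nonneg_of_neg_pi_div_two_le_of_le <;> nlinarith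

/-- The additive character `x ↦ exp (2 π i x)`. -/
noncomputable def expChar (x : ℝ) : ℂ := Complex.exp ((2 * Real.pi * x : ℝ) * Complex.I)

lemma expChar_zero : expChar 0 = 1 := by simp [expChar]

lemma expChar_add (x y : ℝ) : expChar (x + y) = expChar x * expChar y := by
  rw [expChar, expChar, expChar, ← Complex.exp_add]
  push_cast
  ring_nf

lemma expChar_re (x : ℝ) : (expChar x).re = Real.cos (2 * Real.pi * x) :=
  Complex.exp_ofReal_mul_I_re _

lemma expChar_im (x : ℝ) : (expChar x).im = Real.sin (2 * Real.pi * x) :=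
  Complex.exp_ofReal_mul_I_im _

lemma norm_expChar (x : ℝ) : ‖expChar x‖ = 1 := Complex.norm_exp_ofReal_mul_I _

lemma conj_expChar (x : ℝ) : (starRingEnd ℂ) (expChar x) = expChar (-x) := by
  apply Complex.ext <;> simp [expChar_re, expChar_im]

lemma expChar_natCast_mul (n : ℕ) (x : ℝ) : expChar (n * x) = expChar x ^ n := by
  rw [expChar, expChar, ← Complex.exp_nat_mul]
  push_cast
  ring_nf

lemma expChar_sum {ι : Type*} (s : Finset ι) (f : ι → ℝ) :
    expChar (∑ i ∈ s, f i) = ∏ i ∈ s, expChar (f i) := by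
  classical
  induction s using Finset.induction_on with
  | empty => simp [expChar_zero]
  | insert a s ha ih => rw [Finset.sum_insert ha, Finset.prod_insert ha, expChar_add, ih]

lemma normSq_expChar_sub_one (x : ℝ) :
    ‖expChar x - 1‖ ^ 2 = 2 * (1 - Real.cos (2 * Real.pi * x)) := by
  rw [← Complex.normSq_eq_norm_sq, Complex.normSq_apply]
  simp only [Complex.sub_re, Complex.sub_im, Complex.one_re, Complex.one_im, expChar_re, expChar_im]
  nlinarith [Real.sin_sq_add_cos_sq (2 * Real.pi * x)]

lemma four_mul_distInt_le (x : ℝ) : 4 * distInt x ≤ ‖expChar x - 1‖ := by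
  refine (pow_le_pow_iff_left₀ (by linarith [distInt_nonneg x]) (norm_nonneg _) two_ne_zero).1 ?_
  rw [normSq_expChar_sub_one]
  nlinarith [cos_two_pi_mul_le x]

/-- The Fejér kernel of order `K`. -/
noncomputable def fejerKernel (K : ℕ) (x : ℝ) : ℝ :=
  ‖∑ u ∈ Finset.range K, expChar (u * x)‖ ^ 2 / K

/-- The Fourier coefficients of the Fejér kernel of order `K`. -/
noncomputable def fejerCoeff (K : ℕ) (a : ℤ) : ℝ :=
  (((Finset.range K ×ˢ Finset.range K).filter fun p => (p.1 : ℤ) - p.2 = a).card : ℝ) / K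

lemma fejerKernel_nonneg (K : ℕ) (x : ℝ) : 0 ≤ fejerKernel K x := by
  unfold fejerKernel; positivity

lemma fejerCoeff_nonneg (K : ℕ) (a : ℤ) : 0 ≤ fejerCoeff K a := by
  unfold fejerCoeff; positivity

lemma fejerCoeff_zero {K : ℕ} (hK : 1 ≤ K) : fejerCoeff K 0 = 1 := by
  have h : ((Finset.range K ×ˢ Finset.range K).filter fun p => (p.1 : ℤ) - p.2 = 0)
      = (Finset.range K).diag := by
    ext ⟨u, v⟩
    simp only [Finset.mem_filter, Finset.mem_product, Finset.mem_range, Finset.mem_diag]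
    omega
  have : (K : ℝ) ≠ 0 := by positivity
  rw [fejerCoeff, h, Finset.diag_card, Finset.card_range, div_self this]

lemma fejerKernel_zero {K : ℕ} (hK : 1 ≤ K) : fejerKernel K 0 = K := by
  have : (K : ℝ) ≠ 0 := by positivity
  simp only [fejerKernel, mul_zero, expChar_zero, Finset.sum_const, Finset.card_range,
    nsmul_eq_mul, mul_one, Complex.norm_natCast]
  field_simp

lemma fejerKernel_eq_sum (K : ℕ) (x : ℝ) :
    (fejerKernel K x : ℂ) = ∑ a ∈ Finset.Icc (-(K : ℤ)) K, fejerCoeff K a * expChar (a * x) := by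
  have h1 : ((‖∑ u ∈ Finset.range K, expChar (u * x)‖ ^ 2 : ℝ) : ℂ)
      = ∑ p ∈ Finset.range K ×ˢ Finset.range K, expChar ((((p.1 : ℤ) - p.2 : ℤ) : ℝ) * x) := by
    rw [← Complex.normSq_eq_norm_sq, ← Complex.mul_conj, map_sum, Finset.sum_mul_sum,
      ← Finset.sum_product']
    refine Finset.sum_congr rfl fun p _ => ?_
    rw [conj_expChar, ← expChar_add]
    push_cast
    ring_nf
  have h2 : ∀ p ∈ Finset.range K ×ˢ Finset.range K,
      (p.1 : ℤ) - p.2 ∈ Finset.Icc (-(K : ℤ)) K := by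
    intro p hp
    simp only [Finset.mem_product, Finset.mem_range] at hp
    rw [Finset.mem_Icc]
    omega
  rw [fejerKernel, Complex.ofReal_div, h1, ← Finset.sum_fiberwise_of_maps_to h2, Finset.sum_div]
  refine Finset.sum_congr rfl fun a _ => ?_
  rw [Finset.sum_congr rfl (g := fun _ => expChar (a * x))]
  · rw [Finset.sum_const, fejerCoeff, nsmul_eq_mul]
    push_cast
    ring
  · intro p hp
    rw [(Finset.mem_filter.1 hp).2]

lemma fejerKernel_mul_one_sub_cos (K : ℕ) (x : ℝ) :
    fejerKernel K x * (1 - Real.cos (2 * Real.pi * x))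
      = (1 - Real.cos (2 * Real.pi * (K * x))) / K := by
  have h : (∑ u ∈ Finset.range K, expChar (u * x)) * (expChar x - 1) = expChar (K * x) - 1 := by
    simp_rw [expChar_natCast_mul]
    exact geom_sum_mul _ _
  have h2 := congrArg (fun z => ‖z‖ ^ 2) h
  simp only [norm_mul, mul_pow, normSq_expChar_sub_one] at h2
  rw [fejerKernel, div_mul_eq_mul_div]
  congr 1
  linarith

/-- The product of the Fejér kernel with `cos (2 π x) - 1 + κ`. -/
noncomputable def fejerMinorant (K : ℕ) (κ x : ℝ) : ℝ :=
  fejerKernel K x * (Real.cos (2 * Real.pi * x) - 1 + κ)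

/-- The Fourier coefficients of `fejerMinorant K κ`. -/
noncomputable def fejerMinorantCoeff (K : ℕ) (κ : ℝ) (a : ℤ) : ℝ :=
  κ * fejerCoeff K a + ((if a = K then 1 / (2 * (K : ℝ)) else 0)
    + (if a = -K then 1 / (2 * (K : ℝ)) else 0) - if a = 0 then 1 / (K : ℝ) else 0)

lemma fejerMinorantCoeff_zero {K : ℕ} (hK : 1 ≤ K) (κ : ℝ) :
    fejerMinorantCoeff K κ 0 = κ - 1 / K := by
  have h1 : (0 : ℤ) ≠ K := by omega
  have h2 : (0 : ℤ) ≠ -K := by omega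
  rw [fejerMinorantCoeff, fejerCoeff_zero hK, if_neg h1, if_neg h2, if_pos rfl]
  ring

lemma fejerMinorantCoeff_nonneg {K : ℕ} (hK : 1 ≤ K) {κ : ℝ} (hκ : 1 / K ≤ κ) (a : ℤ) :
    0 ≤ fejerMinorantCoeff K κ a := by
  have hK' : (0 : ℝ) ≤ 1 / K := by positivity
  by_cases ha : a = 0
  · rw [ha, fejerMinorantCoeff_zero hK]
    linarith
  · rw [fejerMinorantCoeff, if_neg ha]
    have h := mul_nonneg (hK'.trans hκ) (fejerCoeff_nonneg K a)
    have h' : (0 : ℝ) ≤ 1 / (2 * K) := by positivity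
    split_ifs <;> linarith

lemma fejerMinorant_eq_sum (K : ℕ) (κ x : ℝ) :
    (fejerMinorant K κ x : ℂ)
      = ∑ a ∈ Finset.Icc (-(K : ℤ)) K, fejerMinorantCoeff K κ a * expChar (a * x) := by
  have h1 : fejerMinorant K κ x
      = κ * fejerKernel K x + (Real.cos (2 * Real.pi * (K * x)) - 1) / K := by
    have h := fejerKernel_mul_one_sub_cos K x
    rw [show (Real.cos (2 * Real.pi * (K * x)) - 1) / K
      = -((1 - Real.cos (2 * Real.pi * (K * x))) / K) by ring, ← h, fejerMinorant]
    ring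
  have h2 : (Real.cos (2 * Real.pi * (K * x)) : ℂ)
      = (expChar (K * x) + expChar (-(K * x))) / 2 := by
    rw [← conj_expChar, Complex.add_conj, expChar_re]
    push_cast
    ring
  simp only [fejerMinorantCoeff]
  push_cast
  simp only [add_mul, sub_mul, Finset.sum_add_distrib, Finset.sum_sub_distrib, ite_mul, zero_mul,
    apply_ite Complex.ofReal, Complex.ofReal_zero, Finset.sum_ite_eq', Finset.mem_Icc, mul_assoc]
  rw [← Finset.mul_sum, ← fejerKernel_eq_sum, h1]
  have e1 : -(K : ℤ) ≤ K := by omega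
  simp only [e1, le_refl, and_self, if_true, Left.neg_nonpos_iff, Int.natCast_nonneg, Int.cast_neg,
    Int.cast_natCast, Int.cast_zero, zero_mul, expChar_zero]
  push_cast [h2]
  rw [← Complex.ofReal_natCast, neg_mul]
  ring

/-- If no point of a finite sequence in the torus of dimension `d` lies in the box of radius `δ`
around the origin, then one of its Weyl sums of bounded frequency is large; moreover the frequencies
at which all terms of the Weyl sum have nonnegative real part may be excluded. -/
lemma exists_large_weylSum {d K N : ℕ} (hd : 1 ≤ d) (hK : 1 ≤ K) (hN : 1 ≤ N) {δ : ℝ} (hδ : 0 < δ)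
    (hδK : (d : ℝ) ≤ 4 * δ ^ 2 * K) (x : ℕ → Fin d → ℝ)
    (hx : ∀ n ∈ Finset.Icc 1 N, ∃ i, δ < distInt (x n i)) (P : (Fin d → ℤ) → Prop)
    (hP : ∀ m : Fin d → ℤ, (∀ i, |m i| ≤ K) → P m → ∀ n ∈ Finset.Icc 1 N,
      0 ≤ Real.cos (2 * Real.pi * ∑ i, m i * x n i)) :
    ∃ m : Fin d → ℤ, (∀ i, |m i| ≤ K) ∧ ¬ P m ∧
      (N : ℝ) ≤ 2 * K ^ d * ‖∑ n ∈ Finset.Icc 1 N, expChar (∑ i, m i * x n i)‖ := by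
  classical
  by_contra! hcon
  have hd0 : (0 : ℝ) < d := by positivity
  have hK0 : (0 : ℝ) < K := by positivity
  set κ : ℝ := 8 * δ ^ 2 / d with hκ
  have hκK : 2 * (1 / (K : ℝ)) ≤ κ := by
    rw [hκ, mul_one_div, div_le_div_iff₀ hK0 hd0]
    linarith
  have hK1 : 0 < 1 / (K : ℝ) := by positivity
  let w : Fin d → Fin d → ℤ → ℝ := fun i j a =>
    if j = i then fejerMinorantCoeff K κ a else fejerCoeff K a
  have hw : ∀ i j a, 0 ≤ w i j a := fun i j a => by
    dsimp only [w]
    split_ifs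
    · exact fejerMinorantCoeff_nonneg hK (by linarith) a
    · exact fejerCoeff_nonneg K a
  let F : (Fin d → ℝ) → ℝ := fun y =>
    ∑ i, ∏ j, if j = i then fejerMinorant K κ (y j) else fejerKernel K (y j)
  let c : (Fin d → ℤ) → ℝ := fun m => ∑ i, ∏ j, w i j (m j)
  let box : Finset (Fin d → ℤ) := Fintype.piFinset fun _ => Finset.Icc (-(K : ℤ)) K
  have hc : ∀ m, 0 ≤ c m := fun m =>
    Finset.sum_nonneg fun i _ => Finset.prod_nonneg fun j _ => hw i j (m j)
  have hF : ∀ y, (F y : ℂ) = ∑ m ∈ box, c m * expChar (∑ i, m i * y i) := by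
    intro y
    have h1 : ∀ i, ((∏ j, if j = i then fejerMinorant K κ (y j) else fejerKernel K (y j) : ℝ) : ℂ)
        = ∑ m ∈ box, ∏ j, (w i j (m j) : ℂ) * expChar (m j * y j) := by
      intro i
      rw [← Finset.prod_univ_sum (fun _ => Finset.Icc (-(K : ℤ)) K)
        (fun j a => (w i j a : ℂ) * expChar (a * y j)), Complex.ofReal_prod]
      refine Finset.prod_congr rfl fun j _ => ?_
      dsimp only [w]
      split_ifs
      · exact fejerMinorant_eq_sum K κ (y j)
      · exact fejerKernel_eq_sum K (y j)
    dsimp only [F, c]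
    rw [Complex.ofReal_sum, Finset.sum_congr rfl fun i _ => h1 i, Finset.sum_comm]
    refine Finset.sum_congr rfl fun m _ => ?_
    rw [Complex.ofReal_sum, Finset.sum_mul]
    refine Finset.sum_congr rfl fun i _ => ?_
    rw [Finset.prod_mul_distrib, expChar_sum, Complex.ofReal_prod]
  have hF' : ∀ y, F y = (∏ j, fejerKernel K (y j)) *
      (∑ i, (Real.cos (2 * Real.pi * y i) - 1) + d * κ) := by
    intro y
    have h1 : ∀ i, (∏ j, if j = i then fejerMinorant K κ (y j) else fejerKernel K (y j))
        = (∏ j, fejerKernel K (y j)) * (Real.cos (2 * Real.pi * y i) - 1 + κ) := by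
      intro i
      rw [← Fintype.prod_ite_eq' i (fun j => Real.cos (2 * Real.pi * y j) - 1 + κ),
        ← Finset.prod_mul_distrib]
      refine Finset.prod_congr rfl fun j _ => ?_
      split_ifs
      · rfl
      · rw [mul_one]
    dsimp only [F]
    rw [Finset.sum_congr rfl fun i _ => h1 i, ← Finset.mul_sum, Finset.sum_add_distrib]
    simp
  have hFneg : ∀ n ∈ Finset.Icc 1 N, F (x n) ≤ 0 := by
    intro n hn
    obtain ⟨i, hi⟩ := hx n hn
    rw [hF']
    refine mul_nonpos_of_nonneg_of_nonpos
      (Finset.prod_nonneg fun j _ => fejerKernel_nonneg K _) ?_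
    have h1 : ∑ j, (1 - Real.cos (2 * Real.pi * x n j)) ≥ 1 - Real.cos (2 * Real.pi * x n i) :=
      Finset.single_le_sum (f := fun j => 1 - Real.cos (2 * Real.pi * x n j))
        (fun j _ => sub_nonneg.2 (Real.cos_le_one _)) (Finset.mem_univ i)
    have h2 : ∑ j, (Real.cos (2 * Real.pi * x n j) - 1)
        = - ∑ j, (1 - Real.cos (2 * Real.pi * x n j)) := by
      rw [← Finset.sum_neg_distrib]
      simp
    have h3 : d * κ = 8 * δ ^ 2 := by rw [hκ]; field_simp
    have h4 := cos_two_pi_mul_le (x n i)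
    rw [h2, h3]
    nlinarith
  have hF0 : ∑ m ∈ box, c m = K ^ d * (d * κ) := by
    have h1 := hF 0
    rw [hF' 0] at h1
    simp only [Pi.zero_apply, fejerKernel_zero hK, mul_zero, Real.cos_zero, sub_self,
      Finset.sum_const_zero, zero_add, expChar_zero, mul_one, Finset.prod_const,
      Finset.card_univ, Fintype.card_fin] at h1
    exact_mod_cast h1.symm
  have hc0 : d * κ / 2 ≤ c 0 := by
    have h1 : ∀ i : Fin d, ∏ j, w i j 0 = κ - 1 / K := by
      intro i
      dsimp only [w]
      rw [fejerMinorantCoeff_zero hK, fejerCoeff_zero hK, Fintype.prod_ite_eq']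
    have h2 : c 0 = d * (κ - 1 / K) := by
      dsimp only [c, Pi.zero_apply]
      rw [Finset.sum_congr rfl fun i _ => h1 i, Finset.sum_const, Finset.card_univ,
        Fintype.card_fin, nsmul_eq_mul]
    rw [h2]
    nlinarith
  let S : (Fin d → ℤ) → ℝ := fun m =>
    (∑ n ∈ Finset.Icc 1 N, expChar (∑ i, m i * x n i)).re
  have hsum : ∑ m ∈ box, c m * S m ≤ 0 := by
    have h1 : ∑ m ∈ box, c m * S m = ∑ n ∈ Finset.Icc 1 N, F (x n) := by
      have h2 : ∀ n, F (x n) = ∑ m ∈ box, c m * (expChar (∑ i, m i * x n i)).re := by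
        intro n
        have h3 := congrArg Complex.re (hF (x n))
        rw [Complex.ofReal_re, Complex.re_sum] at h3
        simpa only [Complex.re_ofReal_mul] using h3
      rw [Finset.sum_congr rfl fun n _ => h2 n, Finset.sum_comm]
      refine Finset.sum_congr rfl fun m _ => ?_
      dsimp only [S]
      rw [Complex.re_sum, Finset.mul_sum]
    rw [h1]
    exact Finset.sum_nonpos hFneg
  set η : ℝ := N / (2 * K ^ d) with hη
  have hη0 : 0 < η := by positivity
  have hS : ∀ m ∈ box, 0 ≤ S m + η := by
    intro m hm
    have hm' : ∀ i, |m i| ≤ K := fun i => by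
      have := Fintype.mem_piFinset.1 hm i
      rw [Finset.mem_Icc] at this
      exact abs_le.2 this
    by_cases hPm : P m
    · have : 0 ≤ S m := by
        dsimp only [S]
        rw [Complex.re_sum]
        refine Finset.sum_nonneg fun n hn => ?_
        rw [expChar_re]
        exact hP m hm' hPm n hn
      linarith
    · have h1 := hcon m hm' hPm
      have h2 := Complex.abs_re_le_norm (∑ n ∈ Finset.Icc 1 N, expChar (∑ i, m i * x n i))
      have h3 := neg_abs_le (S m)
      have h4 : ‖∑ n ∈ Finset.Icc 1 N, expChar (∑ i, m i * x n i)‖ < η := by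
        rw [hη, lt_div_iff₀ (by positivity)]
        linarith
      dsimp only [S] at h3 ⊢
      linarith
  have hS0 : S 0 = N := by
    simp [S, expChar_zero]
  have h0box : (0 : Fin d → ℤ) ∈ box := by
    simp [box, Fintype.mem_piFinset]
  have hmain : c 0 * (S 0 + η) ≤ ∑ m ∈ box, c m * (S m + η) :=
    Finset.single_le_sum (f := fun m => c m * (S m + η))
      (fun m hm => mul_nonneg (hc m) (hS m hm)) h0box
  have hexp : ∑ m ∈ box, c m * (S m + η) = ∑ m ∈ box, c m * S m + d * κ / 2 * N := by
    simp only [mul_add, Finset.sum_add_distrib]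
    rw [← Finset.sum_mul, hF0, hη]
    field_simp
  have hκ0 : 0 < d * κ / 2 := by
    have : 0 < κ := by linarith
    positivity
  rw [hexp, hS0] at hmain
  nlinarith

/-- A large set of integers in `[-N, N]` contains two elements whose difference is `q * l` with
`s ≤ l < W`: apply the pigeonhole principle to residue classes modulo `q` in blocks of length
`q * W`. -/
lemma exists_sub_eq_mul {B : Finset ℤ} {N q W s : ℕ} (hq : 1 ≤ q) (hW : 1 ≤ W)
    (hBN : ∀ h ∈ B, |h| ≤ N) (hcard : s * (q * (2 * N / (q * W) + 1)) < B.card) :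
    ∃ l : ℕ, s ≤ l ∧ l < W ∧ ∃ h ∈ B, ∃ h' ∈ B, h = h' + q * l := by
  have hq0 : (0 : ℤ) < q := by exact_mod_cast hq
  have hW0 : (0 : ℤ) < W := by exact_mod_cast hW
  let T : Finset (ℤ × ℤ) := Finset.Ico 0 (q : ℤ) ×ˢ Finset.Icc 0 (2 * N / (q * W) : ℤ)
  let φ : ℤ → ℤ × ℤ := fun h => ((h + N) % q, (h + N) / q / W)
  have hφ : ∀ h ∈ B, φ h ∈ T := by
    intro h hh
    have h1 := abs_le.1 (hBN h hh)
    simp only [φ, T, Finset.mem_product, Finset.mem_Ico, Finset.mem_Icc]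
    refine ⟨⟨Int.emod_nonneg _ hq0.ne', Int.emod_lt_of_pos _ hq0⟩,
      Int.ediv_nonneg (Int.ediv_nonneg (by linarith) hq0.le) hW0.le, ?_⟩
    rw [Int.ediv_ediv_of_nonneg hq0.le]
    exact Int.ediv_le_ediv (by positivity) (by linarith)
  have hT : T.card = q * (2 * N / (q * W) + 1) := by
    have : (2 * N / (q * W) : ℤ) = ((2 * N / (q * W) : ℕ) : ℤ) := by push_cast; rfl
    simp only [T, Finset.card_product, Int.card_Ico, Int.card_Icc, this]
    congr 1
  obtain ⟨y, -, hy⟩ := Finset.exists_lt_card_fiber_of_mul_lt_card_of_maps_to hφ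
    (n := s) (by rw [hT, mul_comm]; exact hcard)
  set C := B.filter fun h => φ h = y with hC
  have hinj : Set.InjOn (fun h : ℤ => (h + N) / q) C := by
    intro a ha b hb hab
    have h1 : (a + N) % q = (b + N) % q := by
      have ha' := (Finset.mem_filter.1 ha).2
      have hb' := (Finset.mem_filter.1 hb).2
      exact congrArg Prod.fst (ha'.trans hb'.symm)
    have h2 := Int.emod_add_mul_ediv (a + N) q
    have h3 := Int.emod_add_mul_ediv (b + N) q
    simp only at hab
    rw [h1, hab] at h2
    linarith
  set D := C.image fun h : ℤ => (h + N) / q with hD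
  have hDcard : s < D.card := by rw [hD, Finset.card_image_of_injOn hinj]; exact hy
  have hDne : D.Nonempty := Finset.card_pos.1 (by omega)
  have hsub : D ⊆ Finset.Icc (D.min' hDne) (D.max' hDne) := fun t ht =>
    Finset.mem_Icc.2 ⟨Finset.min'_le _ _ ht, Finset.le_max' _ _ ht⟩
  have hle := Finset.card_le_card hsub
  rw [Int.card_Icc] at hle
  obtain ⟨a, haC, ha⟩ := Finset.mem_image.1 (D.max'_mem hDne)
  obtain ⟨b, hbC, hb⟩ := Finset.mem_image.1 (D.min'_mem hDne)
  obtain ⟨haB, ha'⟩ := Finset.mem_filter.1 haC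
  obtain ⟨hbB, hb'⟩ := Finset.mem_filter.1 hbC
  have hab := ha'.trans hb'.symm
  have hmod : (a + N) % q = (b + N) % q := congrArg Prod.fst hab
  have hdiv : (a + N) / q / W = (b + N) / q / W := congrArg Prod.snd hab
  set u := (a + N) / q
  set v := (b + N) / q
  refine ⟨(u - v).toNat, by omega, ?_, a, haB, b, hbB, ?_⟩
  · have h1 := Int.emod_add_mul_ediv u W
    have h2 := Int.emod_add_mul_ediv v W
    have h3 := Int.emod_lt_of_pos u hW0
    have h4 := Int.emod_nonneg v hW0.ne'
    rw [hdiv] at h1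
    zify
    rw [Int.toNat_of_nonneg (by omega)]
    linarith
  · rw [Int.toNat_of_nonneg (by omega)]
    have h2 := Int.emod_add_mul_ediv (a + N) q
    have h3 := Int.emod_add_mul_ediv (b + N) q
    rw [hmod] at h2
    linarith

lemma distInt_mul_le_of_eq_add {B : Finset ℤ} {θ ε : ℝ} (hB : ∀ h ∈ B, distInt (h * θ) ≤ ε)
    {h h' : ℤ} (hh : h ∈ B) (hh' : h' ∈ B) {r : ℕ} (hr : h = h' + r) :
    distInt (r * θ) ≤ 2 * ε := by
  have h1 : (r : ℝ) * θ = h * θ + -(h' * θ) := by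
    rw [hr]
    push_cast
    ring
  have h2 := distInt_add_le (h * θ) (-(h' * θ))
  rw [distInt_neg] at h2
  rw [h1]
  linarith [hB h hh, hB h' hh']

/-- If many `h ∈ [-N, N]` satisfy `‖hθ‖ ≤ ε`, then `‖qθ‖` is of order `ε / N` for some small
positive `q`. -/
lemma exists_distInt_mul_le_of_many {N H : ℕ} {θ ε : ℝ} {B : Finset ℤ} (hH : 1 ≤ H)
    (hBN : ∀ h ∈ B, |h| ≤ N) (hcard : N ≤ H * B.card) (hB : ∀ h ∈ B, distInt (h * θ) ≤ ε)
    (hN : 128 * H ^ 2 ≤ N) (hε : 256 * H * ε ≤ 1) :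
    ∃ q : ℕ, 1 ≤ q ∧ q ≤ 8 * H ∧ N * distInt (q * θ) ≤ 512 * H ^ 2 * ε := by
  obtain ⟨q, hq1, hqW, h, hh, h', hh', hhq⟩ : ∃ l : ℕ, 1 ≤ l ∧ l < 8 * H ∧
      ∃ h ∈ B, ∃ h' ∈ B, h = h' + (1 : ℕ) * l := by
    refine exists_sub_eq_mul (N := N) le_rfl (by omega) hBN ?_
    have h1 : H * (4 * (2 * N / (1 * (8 * H)))) ≤ N := by
      have := Nat.div_mul_le_self (2 * N) (1 * (8 * H))
      nlinarith
    have h2 : H * (4 * (2 * N / (1 * (8 * H)))) ≤ H * B.card := h1.trans hcard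
    have h3 := Nat.le_of_mul_le_mul_left h2 (by omega)
    have h4 : H * 128 ≤ H * B.card := by nlinarith
    have h5 := Nat.le_of_mul_le_mul_left h4 (by omega)
    omega
  have hqθ : distInt (q * θ) ≤ 2 * ε :=
    distInt_mul_le_of_eq_add hB hh hh' (by simpa using hhq)
  have hHR : (1 : ℝ) ≤ H := by exact_mod_cast hH
  set φ : ℝ := q * θ - round (q * θ) with hφ
  have hφd : |φ| = distInt (q * θ) := rfl
  have key : ∀ W : ℕ, 8 * H ≤ W → q * W ≤ N → W * |φ| ≤ 1 / 4 → W * |φ| ≤ 32 * H * ε := by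
    intro W hW hqN hWφ
    set s := W / (8 * H) with hs
    have hs1 : 1 ≤ s := (Nat.one_le_div_iff (by omega)).2 hW
    have hs2 : s * (8 * H) ≤ W := Nat.div_mul_le_self _ _
    have hs3 : W < 16 * H * s := by
      have := Nat.lt_mul_div_succ W (show 0 < 8 * H by omega)
      rw [← hs] at this
      nlinarith
    have hB0 : 0 < B.card := by
      rcases Nat.eq_zero_or_pos B.card with h0 | h0
      · rw [h0] at hcard
        nlinarith
      · exact h0
    obtain ⟨l, hsl, hlW, h, hh, h', hh', hhl⟩ : ∃ l : ℕ, s ≤ l ∧ l < W ∧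
        ∃ h ∈ B, ∃ h' ∈ B, h = h' + q * l := by
      refine exists_sub_eq_mul hq1 (by omega) hBN ?_
      have h1 : W * (q * (2 * N / (q * W) + 1)) ≤ 3 * N := by
        have := Nat.div_mul_le_self (2 * N) (q * W)
        nlinarith
      have h2 : W * (s * (q * (2 * N / (q * W) + 1))) < W * B.card := by
        calc W * (s * (q * (2 * N / (q * W) + 1)))
            = s * (W * (q * (2 * N / (q * W) + 1))) := by ring
          _ ≤ s * (3 * N) := Nat.mul_le_mul_left _ h1
          _ ≤ s * (3 * (H * B.card)) := by gcongr
          _ < s * (8 * H) * B.card := by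
            have : 0 < s * H * B.card := by positivity
            nlinarith
          _ ≤ W * B.card := by gcongr
      exact Nat.lt_of_mul_lt_mul_left h2
    have h1 : distInt ((q * l : ℕ) * θ) ≤ 2 * ε :=
      distInt_mul_le_of_eq_add hB hh hh' (by simpa using hhl)
    have h2 : ((q * l : ℕ) : ℝ) * θ = l * φ + (l * round (q * θ) : ℤ) := by
      rw [hφ]
      push_cast
      ring
    have h3 : |l * φ| = l * |φ| := by rw [abs_mul, Nat.abs_cast]
    have h4 : l * |φ| ≤ W * |φ| := by gcongr
    rw [h2, distInt_add_intCast, distInt_eq_abs (by linarith), h3] at h1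
    have h5 : s * |φ| ≤ l * |φ| := by gcongr
    have h6 : (W : ℝ) * |φ| ≤ 16 * H * s * |φ| := by
      gcongr
      exact_mod_cast hs3.le
    nlinarith
  refine ⟨q, hq1, hqW.le, ?_⟩
  rw [← hφd]
  have hNq := Nat.lt_mul_div_succ N (show 0 < q by omega)
  set W := N / q with hWdef
  have hqW' : q * W ≤ N := Nat.mul_div_le N q
  have hW8 : 8 * H ≤ W := by
    rw [hWdef, Nat.le_div_iff_mul_le (by omega)]
    nlinarith
  have hN2 : (N : ℝ) ≤ 16 * H * W := by
    have : N ≤ 16 * H * W := by nlinarith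
    exact_mod_cast this
  by_cases hW : W * |φ| ≤ 1 / 4
  · have h1 := key W hW8 hqW' hW
    calc N * |φ| ≤ 16 * H * W * |φ| := by gcongr
      _ = 16 * H * (W * |φ|) := by ring
      _ ≤ 16 * H * (32 * H * ε) := by gcongr
      _ = 512 * H ^ 2 * ε := by ring
  · exfalso
    push Not at hW
    have hφ0 : 0 < |φ| := by
      rcases (abs_nonneg φ).eq_or_lt with h0 | h0
      · rw [← h0, mul_zero] at hW
        linarith
      · exact h0
    set V := ⌊1 / (4 * |φ|)⌋₊ with hV
    have hV1 : (V : ℝ) ≤ 1 / (4 * |φ|) := Nat.floor_le (by positivity)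
    have hV2 : 1 / (4 * |φ|) < V + 1 := Nat.lt_floor_add_one _
    rw [le_div_iff₀ (by positivity)] at hV1
    rw [div_lt_iff₀ (by positivity)] at hV2
    have hV8 : 8 * H ≤ V := by
      refine Nat.le_floor ?_
      rw [le_div_iff₀ (by positivity)]
      push_cast
      nlinarith
    have hVW : V ≤ W := by
      have : (V : ℝ) < W := by
        by_contra! hcon
        nlinarith
      exact_mod_cast this.le
    have h1 := key V hV8 ((Nat.mul_le_mul_left q hVW).trans hqW') (by linarith)
    nlinarith

/-- `f` behaves like a polynomial of degree at most `k` whose leading coefficient is `θ / k!`: its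
`k`-th iterated differences with steps `h₁, …, h_k` are constant, equal to `h₁ ⋯ h_k θ`. -/
def HasTopDifference : ℕ → ℝ → (ℤ → ℝ) → Prop
  | 0, θ, f => ∀ n, f n = θ
  | k + 1, θ, f => ∀ h : ℤ, HasTopDifference k (h * θ) fun n => f (n + h) - f n

namespace HasTopDifference

lemma add {k : ℕ} {a b : ℝ} {f g : ℤ → ℝ} (hf : HasTopDifference k a f)
    (hg : HasTopDifference k b g) : HasTopDifference k (a + b) fun n => f n + g n := by
  induction k generalizing a b f g with
  | zero => exact fun n => congrArg₂ (· + ·) (hf n) (hg n)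
  | succ k ih =>
    intro h
    have := ih (hf h) (hg h)
    simpa only [mul_add, add_sub_add_comm] using this

lemma const_mul {k : ℕ} {a : ℝ} {f : ℤ → ℝ} (c : ℝ) (hf : HasTopDifference k a f) :
    HasTopDifference k (c * a) fun n => c * f n := by
  induction k generalizing a f with
  | zero => exact fun n => congrArg (c * ·) (hf n)
  | succ k ih =>
    intro h
    have := ih (hf h)
    simpa only [mul_sub, mul_left_comm] using this

lemma zero (k : ℕ) : HasTopDifference k 0 fun _ => 0 := by
  induction k with
  | zero => exact fun n => rfl
  | succ k ih =>
    intro h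
    simpa only [mul_zero, sub_zero] using ih

lemma sum {ι : Type*} {k : ℕ} (s : Finset ι) {a : ι → ℝ} {f : ι → ℤ → ℝ}
    (hf : ∀ i ∈ s, HasTopDifference k (a i) (f i)) :
    HasTopDifference k (∑ i ∈ s, a i) fun n => ∑ i ∈ s, f i n := by
  classical
  induction s using Finset.induction_on with
  | empty => simpa only [Finset.sum_empty] using zero k
  | insert i s hi ih =>
    simp only [Finset.sum_insert hi]
    exact (hf i (Finset.mem_insert_self i s)).add
      (ih fun j hj => hf j (Finset.mem_insert_of_mem hj))

lemma succ {k : ℕ} {a : ℝ} {f : ℤ → ℝ} (hf : HasTopDifference k a f) :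
    HasTopDifference (k + 1) 0 f := by
  induction k generalizing a f with
  | zero =>
    intro h n
    simp [hf (n + h), hf n]
  | succ k ih =>
    intro h
    rw [mul_zero]
    exact ih (hf h)

lemma of_lt {j k : ℕ} (hjk : j < k) {a : ℝ} {f : ℤ → ℝ} (hf : HasTopDifference j a f) :
    HasTopDifference k 0 f := by
  induction k, hjk using Nat.le_induction with
  | base => exact hf.succ
  | succ k _ ih => exact ih.succ

lemma pow (k : ℕ) : HasTopDifference k k.factorial fun n => (n : ℝ) ^ k := by
  induction k using Nat.strong_induction_on with
  | _ k ih =>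
    cases k with
    | zero => exact fun n => by simp
    | succ k =>
      intro h
      have h1 : (fun n : ℤ => ((n + h : ℤ) : ℝ) ^ (k + 1) - (n : ℝ) ^ (k + 1)) = fun n : ℤ =>
          ∑ j ∈ Finset.range (k + 1),
            ((h : ℝ) ^ (k + 1 - j) * (k + 1).choose j) * (n : ℝ) ^ j := by
        funext n
        push_cast
        rw [add_pow, Finset.sum_range_succ]
        simp only [Nat.sub_self, pow_zero, mul_one, Nat.choose_self, Nat.cast_one,
          add_sub_cancel_right]
        exact Finset.sum_congr rfl fun j _ => by ring
      have h2 : (h : ℝ) * (k + 1).factorial = ∑ j ∈ Finset.range (k + 1),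
          ((h : ℝ) ^ (k + 1 - j) * (k + 1).choose j) * (if j = k then (k.factorial : ℝ) else 0) := by
        rw [Finset.sum_range_succ, Finset.sum_eq_zero]
        · simp [Nat.factorial_succ]
          ring
        · intro j hj
          rw [if_neg (Finset.mem_range.1 hj).ne, mul_zero]
      rw [h1, h2]
      refine sum _ fun j hj => const_mul _ ?_
      have hj' := Finset.mem_range.1 hj
      split_ifs with hjk
      · subst hjk
        exact ih j hj'
      · exact of_lt (by omega) (ih j hj')

end HasTopDifference

/-- Weyl differencing. -/
lemma norm_sum_expChar_sq_le (f : ℤ → ℝ) {M M' : ℤ} {N : ℕ} (hM : M' ≤ M + N) :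
    ‖∑ n ∈ Finset.Ico M M', expChar (f n)‖ ^ 2 ≤ ∑ h ∈ Finset.Icc (-(N : ℤ)) N,
      ‖∑ n ∈ Finset.Ico (max M (M - h)) (min M' (M' - h)), expChar (f (n + h) - f n)‖ := by
  have h1 : ((‖∑ n ∈ Finset.Ico M M', expChar (f n)‖ ^ 2 : ℝ) : ℂ)
      = ∑ p ∈ Finset.Ico M M' ×ˢ Finset.Ico M M', expChar (f p.1 - f p.2) := by
    rw [← Complex.normSq_eq_norm_sq, ← Complex.mul_conj, map_sum, Finset.sum_mul_sum,
      ← Finset.sum_product']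
    refine Finset.sum_congr rfl fun p _ => ?_
    rw [conj_expChar, ← expChar_add, sub_eq_add_neg]
  have h2 : ∀ p ∈ Finset.Ico M M' ×ˢ Finset.Ico M M',
      p.1 - p.2 ∈ Finset.Icc (-(N : ℤ)) N := by
    intro p hp
    simp only [Finset.mem_product, Finset.mem_Ico] at hp
    rw [Finset.mem_Icc]
    omega
  rw [← Finset.sum_fiberwise_of_maps_to h2] at h1
  have h3 := congrArg norm h1
  rw [Complex.norm_real, Real.norm_of_nonneg (by positivity)] at h3
  rw [h3]
  refine (norm_sum_le _ _).trans (le_of_eq ?_)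
  refine Finset.sum_congr rfl fun h _ => ?_
  congr 1
  refine Finset.sum_nbij' (fun p => p.2) (fun n => (n + h, n)) ?_ ?_ ?_ ?_ ?_
  · intro p hp
    simp only [Finset.mem_filter, Finset.mem_product, Finset.mem_Ico] at hp ⊢
    omega
  · intro n hn
    simp only [Finset.mem_filter, Finset.mem_product, Finset.mem_Ico] at hn ⊢
    omega
  · rintro ⟨a, b⟩ hp
    simp only [Finset.mem_filter] at hp
    simp only [Prod.mk.injEq, and_true]
    omega
  · intro n _
    rfl
  · intro p hp
    have := (Finset.mem_filter.1 hp).2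
    rw [show p.1 = p.2 + h by omega]

lemma norm_sum_expChar_le (f : ℤ → ℝ) {M M' : ℤ} {N : ℕ} (hM : M' ≤ M + N) :
    ‖∑ n ∈ Finset.Ico M M', expChar (f n)‖ ≤ N := by
  refine (norm_sum_le _ _).trans ?_
  simp only [norm_expChar, Finset.sum_const, Int.card_Ico, nsmul_eq_mul, mul_one]
  have : (M' - M).toNat ≤ N := by omega
  exact_mod_cast this

lemma distInt_mul_norm_sum_expChar_linear_le {θ : ℝ} {f : ℤ → ℝ} (hf : HasTopDifference 1 θ f)
    (M M' : ℤ) : 4 * distInt θ * ‖∑ n ∈ Finset.Ico M M', expChar (f n)‖ ≤ 2 := by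
  have hstep : ∀ n, expChar (f (n + 1)) = expChar (f n) * expChar θ := by
    intro n
    have h := hf 1 n
    rw [← expChar_add]
    congr 1
    simp only [Int.cast_one, one_mul] at h
    linarith
  have htel : ∀ m : ℕ, (∑ n ∈ Finset.Ico M (M + m), expChar (f n)) * (expChar θ - 1)
      = expChar (f (M + m)) - expChar (f M) := by
    intro m
    induction m with
    | zero => simp
    | succ m ih =>
      have h1 : Finset.Ico M (M + (m + 1 : ℕ)) = insert (M + m) (Finset.Ico M (M + m)) := by
        ext n
        simp only [Finset.mem_insert, Finset.mem_Ico]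
        omega
      rw [h1, Finset.sum_insert (by simp), add_mul, ih,
        show M + ((m + 1 : ℕ) : ℤ) = M + m + 1 by push_cast; ring, hstep]
      ring
  rcases le_total M M' with hMM | hMM
  · have h1 := congrArg norm (htel (M' - M).toNat)
    rw [show M + ((M' - M).toNat : ℤ) = M' by omega, norm_mul] at h1
    have h2 := norm_sub_le (expChar (f M')) (expChar (f M))
    rw [norm_expChar, norm_expChar] at h2
    have h3 := mul_le_mul_of_nonneg_left (four_mul_distInt_le θ)
      (norm_nonneg (∑ n ∈ Finset.Ico M M', expChar (f n)))
    linarith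
  · simp [Finset.Ico_eq_empty (not_lt.2 hMM)]

/-- The exponent `A` works in Weyl's inequality of degree `k`. -/
def WeylInequality (k A : ℕ) : Prop :=
  ∀ (H N : ℕ) (θ : ℝ) (f : ℤ → ℝ) (M M' : ℤ), 2 ≤ H → 1 ≤ N → HasTopDifference k θ f →
    M' ≤ M + N → (N : ℝ) ≤ H * ‖∑ n ∈ Finset.Ico M M', expChar (f n)‖ →
    ∃ q : ℕ, 1 ≤ q ∧ q ≤ H ^ A ∧ distInt (q * θ) * N ^ k ≤ H ^ A

lemma weylInequality_one : WeylInequality 1 1 := by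
  intro H N θ f M M' hH hN hf _ hS
  refine ⟨1, le_rfl, by rw [pow_one]; omega, ?_⟩
  have h1 := distInt_mul_norm_sum_expChar_linear_le hf M M'
  have h2 := mul_le_mul_of_nonneg_left hS (distInt_nonneg θ)
  simp only [Nat.cast_one, one_mul, pow_one]
  nlinarith

lemma WeylInequality.succ {k A : ℕ} (hk : 1 ≤ k) (hA : WeylInequality k A) :
    WeylInequality (k + 1) ((16 + 20 * A) * (k + 1)) := by
  classical
  intro H N θ f M M' hH hN hf hM hS
  have hH1 : 1 ≤ H := by omega
  have hHR : (2 : ℝ) ≤ H := by exact_mod_cast hH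
  have hNR : (1 : ℝ) ≤ N := by exact_mod_cast hN
  rcases le_total N (H ^ (16 + 20 * A)) with hsmall | hbig
  · refine ⟨1, le_rfl, Nat.one_le_pow _ _ (by omega), ?_⟩
    have h1 : (N : ℝ) ^ (k + 1) ≤ H ^ ((16 + 20 * A) * (k + 1)) := by
      rw [pow_mul]
      exact_mod_cast Nat.pow_le_pow_left hsmall (k + 1)
    have h2 := distInt_le_half ((1 : ℕ) * θ)
    have h3 : (0 : ℝ) ≤ N ^ (k + 1) := by positivity
    have h4 := mul_le_mul_of_nonneg_right h2 h3
    refine h4.trans (le_trans ?_ h1)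
    generalize (N : ℝ) ^ (k + 1) = X at h3
    linarith
  set T : ℤ → ℝ := fun h =>
    ‖∑ n ∈ Finset.Ico (max M (M - h)) (min M' (M' - h)), expChar (f (n + h) - f n)‖ with hT
  have hTN : ∀ h, T h ≤ N := fun h =>
    norm_sum_expChar_le (fun n => f (n + h) - f n) (by omega)
  have hsq : (N : ℝ) ^ 2 ≤ H ^ 2 * ∑ h ∈ Finset.Icc (-(N : ℤ)) N, T h := by
    have h1 := norm_sum_expChar_sq_le f hM
    calc (N : ℝ) ^ 2 ≤ (H * ‖∑ n ∈ Finset.Ico M M', expChar (f n)‖) ^ 2 := by gcongr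
      _ = H ^ 2 * ‖∑ n ∈ Finset.Ico M M', expChar (f n)‖ ^ 2 := by ring
      _ ≤ _ := by gcongr
  set H₁ : ℕ := 6 * H ^ 2 with hH₁
  set B : Finset ℤ := (Finset.Icc (-(N : ℤ)) N).filter fun h => (N : ℝ) ≤ H₁ * T h with hB
  have hBcard : N ≤ 2 * H ^ 2 * B.card := by
    have h1 : ∑ h ∈ Finset.Icc (-(N : ℤ)) N, T h
        ≤ ∑ h ∈ Finset.Icc (-(N : ℤ)) N, ((if h ∈ B then (N : ℝ) else 0) + N / H₁) := by
      refine Finset.sum_le_sum fun h hh => ?_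
      have h0 : (0 : ℝ) ≤ N / H₁ := by positivity
      split_ifs with hhB
      · linarith [hTN h]
      · have h2 : ¬ (N : ℝ) ≤ H₁ * T h := fun h3 => hhB (Finset.mem_filter.2 ⟨hh, h3⟩)
        rw [zero_add, le_div_iff₀ (by positivity)]
        linarith
    rw [Finset.sum_add_distrib, Finset.sum_ite_mem,
      Finset.inter_eq_right.2 (Finset.filter_subset _ _), Finset.sum_const, Finset.sum_const,
      Int.card_Icc, nsmul_eq_mul, nsmul_eq_mul] at h1
    have h2 : (((N : ℤ) + 1 - -(N : ℤ)).toNat : ℝ) ≤ 3 * N := by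
      have : ((N : ℤ) + 1 - -(N : ℤ)).toNat ≤ 3 * N := by omega
      exact_mod_cast this
    have h3 : (H : ℝ) ^ 2 * (N / H₁) = N / 6 := by
      rw [hH₁]
      push_cast
      field_simp
    have h4 : (N : ℝ) ^ 2 ≤ H ^ 2 * (B.card * N) + 3 * N * (N / 6) := by
      calc (N : ℝ) ^ 2 ≤ (H : ℝ) ^ 2 * (B.card * N + 3 * N * (N / H₁)) := by
            refine hsq.trans ?_
            gcongr
            refine h1.trans ?_
            gcongr
        _ = (H : ℝ) ^ 2 * (B.card * N) + 3 * N * ((H : ℝ) ^ 2 * (N / H₁)) := by ring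
        _ = _ := by rw [h3]
    have h5 : (N : ℝ) * N ≤ (2 * H ^ 2 * B.card) * N := by nlinarith
    have h6 := le_of_mul_le_mul_right h5 (by linarith)
    exact_mod_cast h6
  have hH₁2 : 2 ≤ H₁ := by nlinarith
  have hchoose : ∀ h : ℤ, ∃ q : ℕ, h ∈ B →
      (1 ≤ q ∧ q ≤ H₁ ^ A ∧ distInt (q * (h * θ)) * N ^ k ≤ H₁ ^ A) := by
    intro h
    by_cases hh : h ∈ B
    · obtain ⟨q, hq⟩ := hA H₁ N (h * θ) _ _ _ hH₁2 hN (hf h) (by omega) (Finset.mem_filter.1 hh).2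
      exact ⟨q, fun _ => hq⟩
    · exact ⟨0, fun h' => absurd h' hh⟩
  choose Q hQ using hchoose
  set P : ℕ := H₁ ^ A with hP
  have hP1 : 1 ≤ P := Nat.one_le_pow _ _ (by omega)
  obtain ⟨q, hq, hqB⟩ := Finset.exists_le_card_fiber_of_nsmul_le_card_of_maps_to
    (s := B) (t := Finset.Icc 1 P) (f := Q) (b := (B.card : ℝ) / P)
    (fun h hh => Finset.mem_Icc.2 ⟨(hQ h hh).1, (hQ h hh).2.1⟩)
    ⟨1, Finset.mem_Icc.2 ⟨le_rfl, hP1⟩⟩ (by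
      rw [Nat.card_Icc, nsmul_eq_mul, Nat.add_sub_cancel]
      exact (mul_div_cancel₀ _ (by positivity)).le)
  rw [Finset.mem_Icc] at hq
  set C := B.filter fun h => Q h = q with hC
  have hBC : B.card ≤ C.card * P := by
    rw [div_le_iff₀ (by positivity)] at hqB
    exact_mod_cast hqB
  have hNk : (N : ℝ) ≤ N ^ k := le_self_pow₀ hNR (by omega)
  set H₂ : ℕ := 2 * H ^ 2 * P with hH₂
  have hPH : P ≤ H ^ (5 * A) := by
    rw [hP, pow_mul]
    refine Nat.pow_le_pow_left ?_ A
    have h1 : 2 ^ 3 ≤ H ^ 3 := Nat.pow_le_pow_left hH 3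
    calc H₁ ≤ H ^ 3 * H ^ 2 := by rw [hH₁]; gcongr; omega
      _ = H ^ 5 := by ring
  have hH₂H : H₂ ≤ H ^ (3 + 5 * A) := by
    calc H₂ ≤ H * H ^ 2 * H ^ (5 * A) := by rw [hH₂]; gcongr
      _ = H ^ (3 + 5 * A) := by ring
  have hbound : 512 * H₂ ^ 2 * P ≤ H ^ (16 + 20 * A) := by
    have h1 : 2 ^ 9 ≤ H ^ 9 := Nat.pow_le_pow_left hH 9
    calc 512 * H₂ ^ 2 * P ≤ H ^ 9 * (H ^ (3 + 5 * A)) ^ 2 * H ^ (5 * A) := by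
          gcongr
          omega
      _ = H ^ (15 + 15 * A) := by ring
      _ ≤ H ^ (16 + 20 * A) := Nat.pow_le_pow_right hH1 (by omega)
  have hH₂1 : 1 ≤ H₂ := by
    have : 0 < H₂ := by positivity
    omega
  obtain ⟨q', hq'1, hq'H, hq'⟩ := exists_distInt_mul_le_of_many (N := N) (H := H₂) (θ := q * θ)
    (ε := P / N ^ k) (B := C) hH₂1
    (fun h hh => abs_le.2 (Finset.mem_Icc.1
      (Finset.mem_filter.1 (Finset.mem_filter.1 hh).1).1))
    (by
      calc N ≤ 2 * H ^ 2 * B.card := hBcard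
        _ ≤ 2 * H ^ 2 * (C.card * P) := by gcongr
        _ = H₂ * C.card := by rw [hH₂]; ring)
    (by
      intro h hh
      obtain ⟨hhB, hhq⟩ := Finset.mem_filter.1 hh
      have h1 := (hQ h hhB).2.2
      rw [hhq] at h1
      rw [le_div_iff₀ (by positivity), mul_left_comm]
      exact_mod_cast h1)
    (by nlinarith)
    (by
      rw [← mul_div_assoc, div_le_one₀ (by positivity)]
      refine le_trans ?_ hNk
      have : 256 * H₂ * P ≤ N := by nlinarith
      exact_mod_cast this)
  refine ⟨q' * q, Nat.mul_pos hq'1 hq.1, ?_, ?_⟩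
  · calc q' * q ≤ 8 * H₂ * P := Nat.mul_le_mul hq'H hq.2
      _ ≤ 512 * H₂ ^ 2 * P := by gcongr ?_ * P; nlinarith
      _ ≤ H ^ (16 + 20 * A) := hbound
      _ ≤ H ^ ((16 + 20 * A) * (k + 1)) := Nat.pow_le_pow_right hH1 (by nlinarith)
  · rw [← mul_div_assoc, le_div_iff₀ (by positivity)] at hq'
    calc distInt ((q' * q : ℕ) * θ) * (N : ℝ) ^ (k + 1)
        = N * distInt (q' * (q * θ)) * N ^ k := by
          push_cast
          ring_nf
      _ ≤ 512 * H₂ ^ 2 * P := hq'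
      _ ≤ H ^ (16 + 20 * A) := by exact_mod_cast hbound
      _ ≤ H ^ ((16 + 20 * A) * (k + 1)) := pow_le_pow_right₀ (by linarith) (by nlinarith)

lemma exists_weylInequality {k : ℕ} (hk : 1 ≤ k) : ∃ A, WeylInequality k A := by
  induction k, hk using Nat.le_induction with
  | base => exact ⟨1, weylInequality_one⟩
  | succ k hk ih =>
    obtain ⟨A, hA⟩ := ih
    exact ⟨_, hA.succ hk⟩

/-- Weyl's inequality for monomials, with polynomial dependence on the parameter `H`. -/
lemma exists_weylInequality_pow {k : ℕ} (hk : 1 ≤ k) : ∃ A : ℕ, ∀ (H N : ℕ) (θ : ℝ), 2 ≤ H →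
    1 ≤ N → (N : ℝ) ≤ H * ‖∑ n ∈ Finset.Icc 1 N, expChar (θ * (n : ℝ) ^ k)‖ →
    ∃ q : ℕ, 1 ≤ q ∧ q ≤ H ^ A ∧ distInt (q * θ) * N ^ k ≤ H ^ A := by
  obtain ⟨A, hA⟩ := exists_weylInequality hk
  refine ⟨k.factorial + A, fun H N θ hH hN hS => ?_⟩
  have hsum : ∑ n ∈ Finset.Icc 1 N, expChar (θ * (n : ℝ) ^ k)
      = ∑ n ∈ Finset.Ico (1 : ℤ) (1 + N), expChar (θ * (n : ℝ) ^ k) := by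
    refine Finset.sum_nbij' (fun n => (n : ℤ)) Int.toNat ?_ ?_ ?_ ?_ ?_
    · intro n hn
      simp only [Finset.mem_Icc, Finset.mem_Ico] at hn ⊢
      omega
    · intro n hn
      simp only [Finset.mem_Icc, Finset.mem_Ico] at hn ⊢
      omega
    · intro n _
      simp
    · intro n hn
      simp only [Finset.mem_Ico] at hn
      exact Int.toNat_of_nonneg (by omega)
    · intro n _
      simp
  rw [hsum] at hS
  obtain ⟨q, hq1, hqH, hq⟩ := hA H N (θ * k.factorial) _ 1 (1 + N) hH hN
    ((HasTopDifference.pow k).const_mul θ) le_rfl hS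
  have hfac : k.factorial ≤ H ^ k.factorial := (Nat.lt_pow_self (by omega)).le
  refine ⟨k.factorial * q, Nat.one_le_iff_ne_zero.2 ?_, ?_, ?_⟩
  · have := Nat.factorial_pos k
    positivity
  · rw [pow_add]
    exact Nat.mul_le_mul hfac hqH
  · have h1 : (((k.factorial * q : ℕ) : ℝ)) * θ = q * (θ * k.factorial) := by
      push_cast
      ring
    rw [h1]
    refine hq.trans (pow_le_pow_right₀ ?_ (by omega))
    exact_mod_cast (by omega : 1 ≤ H)

lemma abs_det_le_pow {d L : ℕ} (hdL : d ≤ L) {M : Matrix (Fin d) (Fin d) ℤ}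
    (hM : ∀ i j, |M i j| ≤ (L ^ 3 : ℕ)) : |M.det| ≤ (L ^ (4 * d) : ℕ) := by
  have h1 := Matrix.det_le (abv := (AbsoluteValue.abs : AbsoluteValue ℤ ℤ)) hM
  have h2 : d.factorial * (L ^ 3) ^ d ≤ L ^ (4 * d) := by
    calc d.factorial * (L ^ 3) ^ d ≤ L ^ d * (L ^ 3) ^ d := by
          gcongr
          exact (Nat.factorial_le_pow d).trans (Nat.pow_le_pow_left hdL d)
      _ = L ^ (4 * d) := by ring
  simp only [AbsoluteValue.abs_apply, Fintype.card_fin, nsmul_eq_mul] at h1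
  exact h1.trans (by exact_mod_cast h2)

/-- Cramer's rule: a linear form with integer coefficients, multiplied by `det M`, is a combination
of the rows of `M` with controlled integer coefficients. -/
lemma distInt_natAbs_det_mul_le {d Z : ℕ} (M : Matrix (Fin d) (Fin d) ℤ) (J : Finset (Fin d))
    (m : Fin d → ℤ) (α : Fin d → ℝ) {ρ : ℝ}
    (hZ : ∀ s, |(M.updateRow s m).det| ≤ Z) (hm : ∀ s ∉ J, (M.updateRow s m).det = 0)
    (hJ : ∀ s ∈ J, distInt (∑ i, M s i * α i) ≤ ρ) (hρ : 0 ≤ ρ) :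
    distInt (M.det.natAbs * ∑ i, m i * α i) ≤ d * (Z * ρ) := by
  have h1 : (M.det : ℝ) * ∑ i, m i * α i
      = ∑ s, ((M.updateRow s m).det : ℝ) * ∑ i, M s i * α i := by
    have h2 := Matrix.mulVec_cramer M.transpose m
    have h3 : ∀ i, M.det * m i = ∑ s, M s i * (M.updateRow s m).det := by
      intro i
      have h4 := congrFun h2 i
      simp only [Matrix.mulVec, dotProduct, Matrix.cramer_transpose_apply, Matrix.transpose_apply,
        Matrix.det_transpose, Pi.smul_apply, smul_eq_mul] at h4
      exact h4.symm
    simp only [Finset.mul_sum]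
    rw [Finset.sum_comm]
    refine Finset.sum_congr rfl fun i _ => ?_
    have h4 : (M.det : ℝ) * m i = ∑ s, (M s i : ℝ) * (M.updateRow s m).det := by
      exact_mod_cast h3 i
    rw [← mul_assoc, h4, Finset.sum_mul]
    exact Finset.sum_congr rfl fun s _ => by ring
  have h2 : distInt (M.det.natAbs * ∑ i, m i * α i) = distInt (M.det * ∑ i, m i * α i) := by
    rw [Nat.cast_natAbs, Int.cast_abs]
    rcases abs_choice (M.det : ℝ) with h | h
    · rw [h]
    · rw [h, neg_mul, distInt_neg]
  rw [h2, h1]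
  refine (distInt_sum_le _ _).trans ?_
  have h3 : ∀ s ∈ (Finset.univ : Finset (Fin d)),
      distInt (((M.updateRow s m).det : ℝ) * ∑ i, M s i * α i) ≤ Z * ρ := by
    intro s _
    by_cases hs : s ∈ J
    · refine (distInt_intCast_mul_le _ _).trans ?_
      refine mul_le_mul ?_ (hJ s hs) (distInt_nonneg _) (by positivity)
      exact_mod_cast hZ s
    · rw [hm s hs]
      simp only [Int.cast_zero, zero_mul]
      have : distInt 0 = 0 := by simp [distInt]
      rw [this]
      positivity
  refine (Finset.sum_le_card_nsmul _ _ _ h3).trans (le_of_eq ?_)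
  rw [Finset.card_univ, Fintype.card_fin, nsmul_eq_mul]

/-- If there is no `n ≤ N` for which all `αᵢ n ^ k` are close to integers, then after passing to
multiples of some `Q` one more row of the matrix `M` can be chosen so that the corresponding
linear form in the `αᵢ` is close to an integer. -/
lemma exists_new_row {k A d L N N' : ℕ} (hk : 1 ≤ k)
    (hA : ∀ (H N : ℕ) (θ : ℝ), 2 ≤ H → 1 ≤ N →
      (N : ℝ) ≤ H * ‖∑ n ∈ Finset.Icc 1 N, expChar (θ * (n : ℝ) ^ k)‖ →
      ∃ q : ℕ, 1 ≤ q ∧ q ≤ H ^ A ∧ distInt (q * θ) * N ^ k ≤ H ^ A)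
    (hd : 1 ≤ d) (hL : 2 ≤ L) (hdL : d ≤ L) (hN' : 1 ≤ N')
    (hNN : N' * (L ^ (4 * d)) ^ (A + 3) ≤ N) (α : Fin d → ℝ)
    (hα : ∀ n ∈ Finset.Icc 1 N, ∃ i, 1 / (L : ℝ) < distInt (α i * (n : ℝ) ^ k))
    {M : Matrix (Fin d) (Fin d) ℤ} (hM : ∀ i j, |M i j| ≤ (L ^ 3 : ℕ)) (hdet : M.det ≠ 0)
    {J : Finset (Fin d)} (hJ : ∀ s ∈ J, distInt (∑ i, M s i * α i) * N ^ k ≤ 1) :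
    ∃ Q : ℕ, 1 ≤ Q ∧ Q * N' ≤ N ∧ ∃ s ∉ J, ∃ m : Fin d → ℤ, (∀ i, |m i| ≤ (L ^ 3 : ℕ)) ∧
      (M.updateRow s m).det ≠ 0 ∧ distInt (∑ i, m i * ((Q : ℝ) ^ k * α i)) * N' ^ k ≤ 1 ∧
      ∀ r ∈ J, distInt (∑ i, M r i * ((Q : ℝ) ^ k * α i)) * N' ^ k ≤ 1 := by
  have hL1 : 1 ≤ L := by omega
  set Z := L ^ (4 * d) with hZ
  have hdZ : d ≤ Z := hdL.trans (Nat.le_self_pow (by omega) L)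
  have hZ4 : 4 ≤ Z := by
    calc 4 ≤ 2 ^ 4 := by norm_num
      _ ≤ L ^ 4 := Nat.pow_le_pow_left hL 4
      _ ≤ Z := Nat.pow_le_pow_right hL1 (by omega)
  set t := M.det.natAbs with ht
  have ht1 : 1 ≤ t := Int.natAbs_pos.2 hdet
  have htZ : t ≤ Z := by
    have := abs_det_le_pow hdL hM
    rw [Int.abs_eq_natAbs] at this
    exact_mod_cast this
  set N₁ := N' * Z ^ A with hN₁
  have hN₁1 : 1 ≤ N₁ := Nat.mul_pos hN' (by positivity)
  have hN₁N : N₁ * Z ^ 3 ≤ N := by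
    calc N₁ * Z ^ 3 = N' * Z ^ (A + 3) := by rw [hN₁]; ring
      _ ≤ N := hNN
  have hN0 : 0 < N := lt_of_lt_of_le (by positivity) hN₁N
  have htN : t * N₁ ≤ N := by
    calc t * N₁ ≤ Z ^ 3 * N₁ := by
          gcongr
          exact htZ.trans (Nat.le_self_pow (by norm_num) Z)
      _ ≤ N := by rw [mul_comm]; exact hN₁N
  have hNk : (0 : ℝ) < (N : ℝ) ^ k := by positivity
  obtain ⟨m, hmK, hmP, hmS⟩ := exists_large_weylSum (K := L ^ 3) (N := N₁) (δ := 1 / L) hd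
    (Nat.one_le_pow _ _ hL1) hN₁1 (by positivity)
    (by
      have h1 : (d : ℝ) ≤ L := by exact_mod_cast hdL
      have h2 : 4 * (1 / (L : ℝ)) ^ 2 * ((L ^ 3 : ℕ) : ℝ) = 4 * L := by
        push_cast
        field_simp
      rw [h2]
      linarith)
    (fun n i => (t : ℝ) ^ k * α i * (n : ℝ) ^ k)
    (by
      intro n hn
      rw [Finset.mem_Icc] at hn
      obtain ⟨i, hi⟩ := hα (t * n) (Finset.mem_Icc.2
        ⟨Nat.mul_pos ht1 hn.1, (Nat.mul_le_mul_left t hn.2).trans htN⟩)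
      refine ⟨i, hi.trans_le (le_of_eq ?_)⟩
      push_cast
      ring_nf)
    (fun m => ∀ s ∉ J, (M.updateRow s m).det = 0)
    (by
      intro m hm hmP n hn
      rw [Finset.mem_Icc] at hn
      have hupd : ∀ s, |(M.updateRow s m).det| ≤ Z := by
        intro s
        refine abs_det_le_pow hdL fun i j => ?_
        rw [Matrix.updateRow_apply]
        split_ifs
        · exact hm j
        · exact hM i j
      have h1 := distInt_natAbs_det_mul_le M J m α (ρ := 1 / (N : ℝ) ^ k) hupd hmP
        (fun s hs => by rw [le_div_iff₀ hNk]; exact hJ s hs) (by positivity)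
      have h2 : ∑ i, m i * ((t : ℝ) ^ k * α i * (n : ℝ) ^ k)
          = (n ^ k * t ^ (k - 1) : ℕ) * (t * ∑ i, m i * α i) := by
        obtain ⟨j, rfl⟩ := Nat.exists_eq_add_of_le' hk
        simp only [Finset.mul_sum, Nat.add_sub_cancel]
        refine Finset.sum_congr rfl fun i _ => ?_
        push_cast
        ring
      apply cos_two_pi_mul_nonneg
      rw [h2]
      refine (distInt_natCast_mul_le _ _).trans ?_
      have h3 : 4 * (n ^ k * t ^ (k - 1)) * (d * Z) ≤ N ^ k := by
        calc 4 * (n ^ k * t ^ (k - 1)) * (d * Z)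
            ≤ Z * (N₁ ^ k * Z ^ (k - 1)) * (Z * Z) := by
              gcongr
              exact hn.2
          _ = N₁ ^ k * Z ^ (k - 1 + 3) := by ring
          _ ≤ N₁ ^ k * Z ^ (3 * k) := by
              gcongr
              · omega
              · omega
          _ = (N₁ * Z ^ 3) ^ k := by rw [pow_mul Z 3 k, ← mul_pow]
          _ ≤ N ^ k := Nat.pow_le_pow_left hN₁N k
      have h4 : (4 : ℝ) * ((n ^ k * t ^ (k - 1) : ℕ) : ℝ) * (d * Z) ≤ (N : ℝ) ^ k := by
        exact_mod_cast h3
      calc ((n ^ k * t ^ (k - 1) : ℕ) : ℝ) * distInt (t * ∑ i, m i * α i)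
          ≤ ((n ^ k * t ^ (k - 1) : ℕ) : ℝ) * (d * (Z * (1 / (N : ℝ) ^ k))) := by gcongr
        _ = (4 * ((n ^ k * t ^ (k - 1) : ℕ) : ℝ) * (d * Z)) / (N : ℝ) ^ k / 4 := by ring
        _ ≤ 1 / 4 := by
            have := (div_le_one₀ hNk).2 h4
            linarith)
  push Not at hmP
  obtain ⟨s, hsJ, hs⟩ := hmP
  set θ : ℝ := ∑ i, m i * ((t : ℝ) ^ k * α i) with hθ
  have hsum : ∀ n : ℕ, ∑ i, m i * ((t : ℝ) ^ k * α i * (n : ℝ) ^ k) = θ * (n : ℝ) ^ k := by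
    intro n
    rw [hθ, Finset.sum_mul]
    exact Finset.sum_congr rfl fun i _ => by ring
  simp only [hsum] at hmS
  have hKZ : 2 * (L ^ 3) ^ d ≤ Z := by
    calc 2 * (L ^ 3) ^ d ≤ L ^ d * (L ^ 3) ^ d := by
          gcongr
          exact hL.trans (Nat.le_self_pow (by omega) L)
      _ = Z := by rw [hZ]; ring
  obtain ⟨q, hq1, hqZ, hq⟩ := hA Z N₁ θ (by omega) hN₁1 (hmS.trans (by
    gcongr
    exact_mod_cast hKZ))
  have hqt : q * t * N' ≤ N := by
    calc q * t * N' ≤ Z ^ A * Z ^ 3 * N' := by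
          gcongr
          exact htZ.trans (Nat.le_self_pow (by norm_num) Z)
      _ = N' * Z ^ (A + 3) := by ring
      _ ≤ N := hNN
  refine ⟨q * t, Nat.mul_pos hq1 ht1, hqt, s, hsJ, m, hmK, hs, ?_, ?_⟩
  · have h1 : ∑ i, m i * (((q * t : ℕ) : ℝ) ^ k * α i) = (q ^ (k - 1) : ℕ) * (q * θ) := by
      obtain ⟨j, rfl⟩ := Nat.exists_eq_add_of_le' hk
      simp only [hθ, Finset.mul_sum, Nat.add_sub_cancel]
      refine Finset.sum_congr rfl fun i _ => ?_
      push_cast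
      ring
    have hZA : (0 : ℝ) < (Z : ℝ) ^ A := by positivity
    have hd0 := distInt_nonneg (q * θ)
    have h2 : ((q ^ (k - 1) : ℕ) : ℝ) ≤ (Z : ℝ) ^ (A * (k - 1)) := by
      rw [pow_mul]
      exact_mod_cast Nat.pow_le_pow_left hqZ (k - 1)
    rw [h1]
    refine le_of_mul_le_mul_right (a := (Z : ℝ) ^ A) ?_ hZA
    calc distInt ((q ^ (k - 1) : ℕ) * (q * θ)) * N' ^ k * Z ^ A
        ≤ ((q ^ (k - 1) : ℕ) * distInt (q * θ)) * N' ^ k * Z ^ A := by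
          gcongr
          exact distInt_natCast_mul_le _ _
      _ ≤ ((Z : ℝ) ^ (A * (k - 1)) * distInt (q * θ)) * N' ^ k * Z ^ A := by gcongr
      _ = distInt (q * θ) * (N₁ : ℝ) ^ k := by
          obtain ⟨j, rfl⟩ := Nat.exists_eq_add_of_le' hk
          rw [hN₁, Nat.add_sub_cancel]
          push_cast
          ring
      _ ≤ 1 * (Z : ℝ) ^ A := by rw [one_mul]; exact hq
  · intro r hr
    have h1 : ∑ i, M r i * (((q * t : ℕ) : ℝ) ^ k * α i)
        = ((q * t) ^ k : ℕ) * ∑ i, M r i * α i := by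
      rw [Finset.mul_sum]
      refine Finset.sum_congr rfl fun i _ => ?_
      push_cast
      ring
    have hd0 := distInt_nonneg (∑ i, M r i * α i)
    have h2 : (((q * t) ^ k : ℕ) : ℝ) * (N' : ℝ) ^ k ≤ (N : ℝ) ^ k := by
      rw [← Nat.cast_pow, ← Nat.cast_mul, ← mul_pow]
      exact_mod_cast Nat.pow_le_pow_left hqt k
    rw [h1]
    calc distInt (((q * t) ^ k : ℕ) * ∑ i, M r i * α i) * (N' : ℝ) ^ k
        ≤ (((q * t) ^ k : ℕ) * distInt (∑ i, M r i * α i)) * (N' : ℝ) ^ k := by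
          gcongr
          exact distInt_natCast_mul_le _ _
      _ = distInt (∑ i, M r i * α i) * ((((q * t) ^ k : ℕ) : ℝ) * (N' : ℝ) ^ k) := by ring
      _ ≤ distInt (∑ i, M r i * α i) * (N : ℝ) ^ k := by gcongr
      _ ≤ 1 := hJ r hr

lemma exists_distInt_le_of_rows {k A d L : ℕ} (hk : 1 ≤ k)
    (hA : ∀ (H N : ℕ) (θ : ℝ), 2 ≤ H → 1 ≤ N →
      (N : ℝ) ≤ H * ‖∑ n ∈ Finset.Icc 1 N, expChar (θ * (n : ℝ) ^ k)‖ →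
      ∃ q : ℕ, 1 ≤ q ∧ q ≤ H ^ A ∧ distInt (q * θ) * N ^ k ≤ H ^ A)
    (hd : 1 ≤ d) (hL : 2 ≤ L) (hdL : d ≤ L) (r N : ℕ)
    (hN : ((L ^ (4 * d)) ^ (A + 3)) ^ (r + 1) ≤ N) (α : Fin d → ℝ)
    {M : Matrix (Fin d) (Fin d) ℤ} (hM : ∀ i j, |M i j| ≤ (L ^ 3 : ℕ)) (hdet : M.det ≠ 0)
    {J : Finset (Fin d)} (hJr : Jᶜ.card = r)
    (hJ : ∀ s ∈ J, distInt (∑ i, M s i * α i) * N ^ k ≤ 1) :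
    ∃ n ∈ Finset.Icc 1 N, ∀ i, distInt (α i * (n : ℝ) ^ k) ≤ 1 / (L : ℝ) := by
  induction r generalizing N α M J with
  | zero =>
    by_contra! hcon
    obtain ⟨Q, -, -, s, hs, -⟩ := exists_new_row (N' := 1) hk hA hd hL hdL le_rfl
      (by simpa using hN) α hcon hM hdet hJ
    rw [Finset.card_eq_zero] at hJr
    exact absurd (Finset.mem_compl.2 hs) (by simp [hJr])
  | succ r ih =>
    by_contra! hcon
    set G := (L ^ (4 * d)) ^ (A + 3) with hG
    have hG1 : 1 ≤ G := Nat.one_le_pow _ _ (Nat.one_le_pow _ _ (by omega))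
    obtain ⟨Q, hQ1, hQN, s, hs, m, hm, hdet', hmα, hMα⟩ := exists_new_row (N' := G ^ (r + 1)) hk hA
      hd hL hdL (Nat.one_le_pow _ _ hG1) (by rw [← hG, ← pow_succ]; exact hN) α hcon hM hdet hJ
    obtain ⟨n, hn, hnα⟩ := ih (G ^ (r + 1)) le_rfl (fun i => (Q : ℝ) ^ k * α i)
      (M := M.updateRow s m) (J := insert s J)
      (by
        intro i j
        rw [Matrix.updateRow_apply]
        split_ifs
        · exact hm j
        · exact hM i j)
      hdet'
      (by
        rw [Finset.compl_insert, Finset.card_erase_of_mem (Finset.mem_compl.2 hs), hJr]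
        rfl)
      (by
        intro i hi
        rcases eq_or_ne i s with rfl | his
        · simpa only [Matrix.updateRow_self] using hmα
        · simpa only [Matrix.updateRow_ne his] using hMα i (Finset.mem_of_mem_insert_of_ne hi his))
    rw [Finset.mem_Icc] at hn
    obtain ⟨i, hi⟩ := hcon (Q * n) (Finset.mem_Icc.2
      ⟨Nat.mul_pos hQ1 hn.1, (Nat.mul_le_mul_left Q hn.2).trans hQN⟩)
    have h := hnα i
    rw [show (Q : ℝ) ^ k * α i * (n : ℝ) ^ k = α i * ((Q * n : ℕ) : ℝ) ^ k by push_cast; ring] at h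
    linarith

/-- **Schmidt's theorem on small fractional parts of polynomials.**
Fix `k ≥ 1`. There are `c, C > 0` such that for all `d, N ≥ 1` and all reals `α₁,…,α_d`,
`min_{1 ≤ n ≤ N} max_{1 ≤ i ≤ d} ‖α_i n^k‖_{ℝ/ℤ} ≤ C · d · N^{-c/d²}`, where
`‖x‖_{ℝ/ℤ} = |x - round x|` is the distance to the nearest integer. -/
theorem schmidt_small_fractional_parts (k : ℕ) (hk : 1 ≤ k) :
    ∃ c C : ℝ, 0 < c ∧ 0 < C ∧
      ∀ d N : ℕ, 1 ≤ d → 1 ≤ N → ∀ α : Fin d → ℝ,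
        ∃ n ∈ Finset.Icc 1 N, ∀ i : Fin d,
          |α i * (n : ℝ) ^ k - round (α i * (n : ℝ) ^ k)|
            ≤ C * d * (N : ℝ) ^ (-(c / (d : ℝ) ^ 2)) := by
  obtain ⟨A, hA⟩ := exists_weylInequality_pow hk
  refine ⟨1 / (8 * (A + 3)), 4, by positivity, by norm_num, fun d N hd hN α => ?_⟩
  have hdR : (1 : ℝ) ≤ d := by exact_mod_cast hd
  have hNR : (1 : ℝ) ≤ N := by exact_mod_cast hN
  set c : ℝ := 1 / (8 * (A + 3)) with hc
  set Y : ℝ := (N : ℝ) ^ (c / (d : ℝ) ^ 2) with hY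
  have hY1 : 1 ≤ Y := Real.one_le_rpow hNR (by positivity)
  have hY0 : 0 < Y := by linarith
  rw [Real.rpow_neg (by positivity), ← hY]
  rcases le_total Y (d + 2) with hsmall | hbig
  · refine ⟨1, Finset.mem_Icc.2 ⟨le_rfl, hN⟩, fun i => (distInt_le_half _).trans ?_⟩
    rw [← div_eq_mul_inv, le_div_iff₀ hY0]
    linarith
  · set L := ⌊Y⌋₊ with hL
    have hLd : d + 2 ≤ L := Nat.le_floor (by exact_mod_cast hbig)
    have hLY : (L : ℝ) ≤ Y := Nat.floor_le hY0.le
    have hYL : Y < L + 1 := Nat.lt_floor_add_one Y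
    have hYpow : Y ^ (8 * (A + 3) * d ^ 2) = N := by
      rw [hY, ← Real.rpow_natCast, ← Real.rpow_mul (by positivity)]
      have : c / (d : ℝ) ^ 2 * ((8 * (A + 3) * d ^ 2 : ℕ) : ℝ) = 1 := by
        rw [hc]
        push_cast
        field_simp
      rw [this, Real.rpow_one]
    have hLN : ((L ^ (4 * d)) ^ (A + 3)) ^ (d + 1) ≤ N := by
      have h1 : ((L ^ (4 * d)) ^ (A + 3)) ^ (d + 1) ≤ L ^ (8 * (A + 3) * d ^ 2) := by
        rw [← pow_mul, ← pow_mul]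
        refine Nat.pow_le_pow_right (by omega) ?_
        calc 4 * d * ((A + 3) * (d + 1)) ≤ 4 * d * ((A + 3) * (d + d)) := by gcongr
          _ = 8 * (A + 3) * d ^ 2 := by ring
      have h2 : (L : ℝ) ^ (8 * (A + 3) * d ^ 2) ≤ N := by
        rw [← hYpow]
        gcongr
      exact h1.trans (by exact_mod_cast h2)
    obtain ⟨n, hn, h⟩ := exists_distInt_le_of_rows hk hA hd (by omega) (by omega) d N hLN α
      (M := 1) (J := ∅)
      (by
        intro i j
        have h1 : (1 : ℤ) ≤ (L ^ 3 : ℕ) := by exact_mod_cast Nat.one_le_pow _ _ (by omega)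
        rw [Matrix.one_apply]
        split_ifs
        · simpa using h1
        · simp)
      (by simp) (by simp) (by simp)
    refine ⟨n, hn, fun i => (h i).trans ?_⟩
    rw [← div_eq_mul_inv, div_le_div_iff₀ (by linarith) hY0]
    nlinarith
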